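/- arXiv:1704.02065 — 6 statements merged into one kernel-verified Lean document; each statement's English description precedes it below -/
import Mathlib

section
/- Let G = (V, E) be a finite simple graph, let Z be a zero forcing set of G of minimum cardinality, and let S ⊆ Z. Then there does not exist a set R ⊆ V with |R| < |S| and cl(S) ⊆ cl(R). -/
/-- A set `C` is closed under the zero forcing color change rule:
whenever a vertex `u ∈ C` has exactly one neighbor outside `C`,
that neighbor also belongs to `C`. -/
def ZFClosed {V : Type*} (G : SimpleGraph V) (C : Set V) : Prop :=
  ∀ u ∈ C, ∀ w : V, G.neighborSet u \ C = {w} → w ∈ C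

/-- The zero forcing closure of `S`: the smallest set containing `S`
that is closed under the color change rule. -/
def zfClosure {V : Type*} (G : SimpleGraph V) (S : Set V) : Set V :=
  ⋂₀ {C : Set V | S ⊆ C ∧ ZFClosed G C}

/-- A fort: a nonempty set such that no vertex outside it has exactly
one neighbor inside it. -/
def IsFort {V : Type*} (G : SimpleGraph V) (F : Set V) : Prop :=
  F.Nonempty ∧ ∀ v ∉ F, ¬ ∃ w : V, G.neighborSet v ∩ F = {w}

/-- The zero forcing number: minimum cardinality of a zero forcing set. -/
noncomputable def zfNumber {V : Type*} (G : SimpleGraph V) : ℕ :=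
  sInf {k : ℕ | ∃ Z : Set V, zfClosure G Z = Set.univ ∧ Z.ncard = k}

theorem subset_zfClosure {V : Type*} (G : SimpleGraph V) (S : Set V) : S ⊆ zfClosure G S :=
  Set.subset_sInter fun _ hC => hC.1

theorem zfClosure_subset {V : Type*} {G : SimpleGraph V} {S C : Set V} (hS : S ⊆ C)
    (hC : ZFClosed G C) : zfClosure G S ⊆ C :=
  Set.sInter_subset_of_mem ⟨hS, hC⟩

theorem zfClosure_subset_zfClosure_union_diff {V : Type*} {G : SimpleGraph V} {R S Z : Set V}
    (hRS : zfClosure G S ⊆ zfClosure G R) : zfClosure G Z ⊆ zfClosure G (R ∪ Z \ S) := by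
  refine Set.subset_sInter fun C hC => zfClosure_subset (fun v hv => ?_) hC.2
  by_cases hvS : v ∈ S
  · exact zfClosure_subset (Set.subset_union_left.trans hC.1) hC.2
      (hRS (subset_zfClosure G S hvS))
  · exact hC.1 (Or.inr ⟨hv, hvS⟩)

theorem min_zf_set_subset_closure_minimal {V : Type*} [Fintype V] (G : SimpleGraph V)
    (Z : Set V) (hZ : zfClosure G Z = Set.univ)
    (hmin : ∀ Z' : Set V, zfClosure G Z' = Set.univ → Z.ncard ≤ Z'.ncard)
    (S : Set V) (hS : S ⊆ Z) :
    ¬ ∃ R : Set V, R.ncard < S.ncard ∧ zfClosure G S ⊆ zfClosure G R := by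
  rintro ⟨R, hcard, hRS⟩
  have hforcing : zfClosure G (R ∪ Z \ S) = Set.univ :=
    Set.univ_subset_iff.mp (hZ ▸ zfClosure_subset_zfClosure_union_diff hRS)
  have hle := hmin _ hforcing
  have hunion := Set.ncard_union_le R (Z \ S)
  have hdiff := Set.ncard_sdiff_add_ncard_of_subset hS
  omega
end

section
/- Let G = (V, E) be a finite simple graph. A set Z ⊆ V is a zero forcing set of G if and only if Z ∩ F ≠ ∅ for every fort F of G. -/
theorem zfClosed_zfClosure {V : Type*} (G : SimpleGraph V) (S : Set V) :
    ZFClosed G (zfClosure G S) := by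
  rintro u hu w hw C ⟨hSC, hC⟩
  by_contra hwC
  have huw : w ∈ G.neighborSet u \ zfClosure G S := hw ▸ Set.mem_singleton w
  have hCl : zfClosure G S ⊆ C := Set.sInter_subset_of_mem ⟨hSC, hC⟩
  refine hwC (hC u (hCl hu) w (Set.Subset.antisymm ?_ ?_))
  · exact hw ▸ Set.sdiff_subset_sdiff_right hCl
  · exact Set.singleton_subset_iff.2 ⟨huw.1, hwC⟩

theorem isFort_compl_iff {V : Type*} (G : SimpleGraph V) (C : Set V) :
    IsFort G Cᶜ ↔ C ≠ Set.univ ∧ ZFClosed G C := by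
  refine and_congr Set.nonempty_compl (forall_congr' fun u => ?_)
  rw [Set.notMem_compl_iff, ← Set.sdiff_eq, not_exists]
  refine forall_congr' fun _ => forall_congr' fun w => forall_congr' fun h => ?_
  have hw : w ∈ G.neighborSet u \ C := h ▸ Set.mem_singleton w
  exact ⟨False.elim, hw.2⟩

theorem zf_set_iff_meets_every_fort {V : Type*} [Fintype V] (G : SimpleGraph V)
    (Z : Set V) :
    zfClosure G Z = Set.univ ↔ ∀ F : Set V, IsFort G F → (Z ∩ F).Nonempty := by
  constructor
  · intro hZ F hF
    rw [← compl_compl F, isFort_compl_iff] at hF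
    by_contra hZF
    have hsub : Z ⊆ Fᶜ := Set.subset_compl_iff_disjoint_right.2
      (Set.disjoint_iff_inter_eq_empty.2 (Set.not_nonempty_iff_eq_empty.1 hZF))
    have hcl : zfClosure G Z ⊆ Fᶜ := Set.sInter_subset_of_mem ⟨hsub, hF.2⟩
    exact hF.1 (Set.univ_subset_iff.1 (hZ ▸ hcl))
  · intro h
    by_contra hne
    obtain ⟨x, hxZ, hx⟩ := h _ ((isFort_compl_iff G _).2 ⟨hne, zfClosed_zfClosure G Z⟩)
    exact hx (Set.mem_sInter.2 fun C hC => hC.1 hxZ)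
end

section
/- Let G = (V, E) be a finite simple graph. The zero forcing number Z(G) equals the minimum cardinality of a set Z ⊆ V that intersects every fort of G (i.e., the minimum zero forcing set problem coincides with the minimum set cover of the family of forts). -/
theorem zfClosure_eq_univ_iff {V : Type*} (G : SimpleGraph V) (Z : Set V) :
    zfClosure G Z = Set.univ ↔ ∀ F : Set V, IsFort G F → (Z ∩ F).Nonempty := by
  rw [zfClosure, Set.sInter_eq_univ]
  constructor
  · intro h F hF
    by_contra hZF
    obtain ⟨hne, hclosed⟩ := (isFort_compl_iff G Fᶜ).1 (by rwa [compl_compl])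
    refine hne (h Fᶜ ⟨?_, hclosed⟩)
    exact Set.disjoint_iff_inter_eq_empty.2 (Set.not_nonempty_iff_eq_empty.1 hZF)
      |>.subset_compl_right
  · rintro h C ⟨hZC, hC⟩
    by_contra hne
    obtain ⟨x, hxZ, hxC⟩ := h Cᶜ ((isFort_compl_iff G C).2 ⟨hne, hC⟩)
    exact hxC (hZC hxZ)

theorem zf_number_eq_min_fort_cover {V : Type*} [Fintype V] (G : SimpleGraph V) :
    zfNumber G =
      sInf {k : ℕ | ∃ Z : Set V,
        (∀ F : Set V, IsFort G F → (Z ∩ F).Nonempty) ∧ Z.ncard = k} := by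
  simp only [zfNumber, zfClosure_eq_univ_iff]
end

section
/- Let G = (V, E) be a finite simple graph, let Z be a zero forcing set of G, and let F be a fort of G. Then Z ∩ F ≠ ∅. -/
/-- The complement of a fort is closed under the color change rule. -/
theorem IsFort.zfClosed_compl {V : Type*} {G : SimpleGraph V} {F : Set V} (hF : IsFort G F) :
    ZFClosed G Fᶜ := by
  intro u hu w hw
  rw [Set.sdiff_compl] at hw
  exact absurd ⟨w, hw⟩ (hF.2 u hu)

theorem zf_set_meets_fort {V : Type*} [Fintype V] (G : SimpleGraph V)
    (Z : Set V) (hZ : zfClosure G Z = Set.univ)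
    (F : Set V) (hF : IsFort G F) :
    (Z ∩ F).Nonempty := by
  by_contra h
  have hZF : Z ⊆ Fᶜ := fun x hxZ hxF => h ⟨x, hxZ, hxF⟩
  obtain ⟨x, hx⟩ := hF.1
  have hx' : x ∈ zfClosure G Z := hZ ▸ Set.mem_univ x
  exact hx' Fᶜ ⟨hZF, hF.zfClosed_compl⟩ hx
end

section
/- Let G = (V, E) be a finite simple graph and let S ⊆ V. If cl(S) ≠ V, then the set V \ cl(S) is a fort of G. -/
theorem compl_closure_isFort {V : Type*} [Fintype V] (G : SimpleGraph V)
    (S : Set V) (h : zfClosure G S ≠ Set.univ) :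
    IsFort G (Set.univ \ zfClosure G S) := by
  refine ⟨?_, ?_⟩
  · obtain ⟨x, hx⟩ := (Set.ne_univ_iff_exists_notMem _).1 h
    exact ⟨x, trivial, hx⟩
  · rintro v hv ⟨w, hw⟩
    have hv' : v ∈ zfClosure G S := by
      by_contra hc
      exact hv ⟨trivial, hc⟩
    have hmem : w ∈ G.neighborSet v ∩ (Set.univ \ zfClosure G S) := hw ▸ rfl
    refine hmem.2.2 (zfClosed_zfClosure G S v hv' w ?_)
    rw [← hw]
    ext y
    simp
end

section
/- Let G = (V, E) be a finite simple graph, let Z* be a zero forcing set of G of minimum cardinality, and let S ⊆ Z*. If V \ cl(S) ⊆ Z*, then cl(S) ∩ Z* = S, and consequently |Z*| = |S| + |V \ cl(S)|. -/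
/-- A set together with the complement of its closure is zero forcing. -/
theorem zfClosure_union_diff_zfClosure {V : Type*} (G : SimpleGraph V) (S : Set V) :
    zfClosure G (S ∪ (Set.univ \ zfClosure G S)) = Set.univ := by
  refine Set.sInter_eq_univ.2 fun C ⟨hsub, hC⟩ => Set.eq_univ_of_forall fun x => ?_
  obtain ⟨hSC, hcompl⟩ := Set.union_subset_iff.1 hsub
  by_cases hx : x ∈ zfClosure G S
  · exact hx C ⟨hSC, hC⟩
  · exact hcompl ⟨Set.mem_univ x, hx⟩

theorem min_zf_set_closure_inter {V : Type*} [Fintype V] (G : SimpleGraph V)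
    (Z : Set V) (hZ : zfClosure G Z = Set.univ)
    (hmin : ∀ Z' : Set V, zfClosure G Z' = Set.univ → Z.ncard ≤ Z'.ncard)
    (S : Set V) (hS : S ⊆ Z)
    (hcompl : Set.univ \ zfClosure G S ⊆ Z) :
    zfClosure G S ∩ Z = S ∧
    Z.ncard = S.ncard + (Set.univ \ zfClosure G S).ncard := by
  have hdisj : Disjoint S (Set.univ \ zfClosure G S) :=
    Set.disjoint_sdiff_right.mono_left (subset_zfClosure G S)
  have heq : S ∪ (Set.univ \ zfClosure G S) = Z :=
    Set.eq_of_subset_of_ncard_le (Set.union_subset hS hcompl)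
      (hmin _ (zfClosure_union_diff_zfClosure G S)) (Set.toFinite Z)
  refine ⟨?_, ?_⟩
  · rw [← heq, Set.inter_union_distrib_left, Set.inter_sdiff_self, Set.union_empty,
      Set.inter_eq_right.2 (subset_zfClosure G S)]
  · rw [← Set.ncard_union_eq hdisj (Set.toFinite _) (Set.toFinite _), heq]
end
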